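/- Let q be an even prime power, let n ≥ 4, let S be a set of even type of size (q+2)q^{n−2} in PG(n,q), and let π be a plane with |S ∩ π| = q+2. Then every 3-space of PG(n,q) containing π meets S in exactly q(q+2) points. -/

import Mathlib

open Submodule

/-- The points of the projective space `PG(n, K)`: the 1-dimensional
`K`-subspaces of `K^{n+1}`. -/
def PGPoint (K : Type*) [Field K] (n : ℕ) : Type _ :=
  {W : Submodule K (Fin (n + 1) → K) // Module.finrank K W = 1}

/-- The set of points of `PG(n, K)` lying in a given linear subspace. -/
def pts {K : Type*} [Field K] {n : ℕ} (W : Submodule K (Fin (n + 1) → K)) :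
    Set (PGPoint K n) :=
  {P | P.1 ≤ W}

/-- `S` is a `k`-dimensional projective subspace of `PG(n, K)`. -/
def IsKSpace {K : Type*} [Field K] {n : ℕ} (k : ℕ) (S : Set (PGPoint K n)) : Prop :=
  ∃ W : Submodule K (Fin (n + 1) → K), Module.finrank K W = k + 1 ∧ S = pts W

/-- A set of points is of even type if every line meets it in an even
number of points. -/
def IsEvenType {K : Type*} [Field K] {n : ℕ} (S : Set (PGPoint K n)) : Prop :=
  ∀ L : Set (PGPoint K n), IsKSpace 1 L → Even (S ∩ L).ncard

/-- `O` is a hyperoval in the plane `π`: a set of `q + 2` points of `π`,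
no three of which are collinear. -/
def IsHyperovalIn {K : Type*} [Field K] {n : ℕ}
    (π O : Set (PGPoint K n)) : Prop :=
  O ⊆ π ∧ O.ncard = Nat.card K + 2 ∧
    ∀ L : Set (PGPoint K n), IsKSpace 1 L → (O ∩ L).ncard ≤ 2

/-- A hypercylinder in `PG(n, K)`, `n ≥ 3`: the set
`(⋃_{P ∈ O} ⟨P, τ⟩) \ τ`, where `O` is a hyperoval in a plane `π` and the
vertex `τ` is an `(n-3)`-dimensional projective subspace (linear dimension
`n - 2`) disjoint from `π`.  (For `n = 3` the vertex is a point.) -/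
def IsHypercylinder {K : Type*} [Field K] {n : ℕ}
    (S : Set (PGPoint K n)) : Prop :=
  ∃ (Wπ T : Submodule K (Fin (n + 1) → K)) (O : Set (PGPoint K n)),
    Module.finrank K Wπ = 3 ∧ Module.finrank K T = n - 2 ∧ Wπ ⊓ T = ⊥ ∧
    IsHyperovalIn (pts Wπ) O ∧
    S = {Q : PGPoint K n | (∃ P ∈ O, Q.1 ≤ P.1 ⊔ T) ∧ ¬ Q.1 ≤ T}


open Polynomial in
lemma aff_range {K F : Type*} [Field K] [Finite K] [Field F] [Algebra K F] (y : F)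
    (hy : y ^ Nat.card K = y) : ∃ c : K, algebraMap K F c = y := by
  classical
  have := Fintype.ofFinite K
  have hq : 1 < Nat.card K := Finite.one_lt_card
  by_contra hne
  push Not at hne
  have hP : (X ^ Nat.card K - X : F[X]) ≠ 0 := FiniteField.X_pow_card_sub_X_ne_zero F hq
  have hsub : (insert y (Finset.univ.image (algebraMap K F))) ⊆ (X ^ Nat.card K - X : F[X]).roots.toFinset := by
    intro z hz
    rw [Multiset.mem_toFinset, mem_roots hP]
    simp only [Finset.mem_insert, Finset.mem_image, Finset.mem_univ, true_and] at hz
    rcases hz with rfl | ⟨c, rfl⟩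
    · rw [IsRoot.def, eval_sub, eval_pow, eval_X, hy, sub_self]
    · simp [← map_pow, Nat.card_eq_fintype_card, FiniteField.pow_card]
  have h1 := Finset.card_le_card hsub
  have h2 := Multiset.toFinset_card_le (X ^ Nat.card K - X : F[X]).roots
  have h3 := card_roots' (X ^ Nat.card K - X : F[X])
  rw [FiniteField.X_pow_card_sub_X_natDegree_eq F hq] at h3
  rw [Finset.card_insert_of_notMem (by simpa using hne),
    Finset.card_image_of_injective _ (algebraMap K F).injective, Finset.card_univ,
    ← Nat.card_eq_fintype_card] at h1
  omega

/-- even along affine lines -/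
def AffEven (K : Type*) {F : Type*} [Field K] [AddCommGroup F] [Module K F] (A : Set F) : Prop :=
  ∀ v : F, v ≠ 0 → ∀ x : F, Even {y | y ∈ A ∧ ∃ c : K, y = x + c • v}.ncard

lemma aff_sum {K F : Type*} [Field K] [Finite K] [Field F] [CharP F 2] [Algebra K F]
    (t : ℕ) (hq : Nat.card K = 2 ^ t) (A : Finset F)
    (hA : AffEven K (A : Set F)) (v : F) (hv : v ≠ 0) (g : F → F) :
    ∑ s ∈ A, g (s ^ Nat.card K + v ^ (Nat.card K - 1) * s) = 0 := by
  classical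
  have hq1 : 1 < Nat.card K := Finite.one_lt_card
  rw [Finset.sum_comp g (fun s => s ^ Nat.card K + v ^ (Nat.card K - 1) * s)]
  apply Finset.sum_eq_zero
  intro b hb
  obtain ⟨x, hx, rfl⟩ := Finset.mem_image.1 hb
  have key : ((A.filter fun a => a ^ Nat.card K + v ^ (Nat.card K - 1) * a = x ^ Nat.card K + v ^ (Nat.card K - 1) * x : Finset F) : Set F) = {y | y ∈ (A : Set F) ∧ ∃ c : K, y = x + c • v} := by
    ext a
    simp only [Finset.coe_filter, Set.mem_ofPred_eq, Finset.mem_coe]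
    refine and_congr_right fun ha => ?_
    have e1 : (a - x) ^ Nat.card K = a ^ Nat.card K - x ^ Nat.card K := by
      rw [hq]; exact sub_pow_char_pow ..
    have e2 : v ^ Nat.card K = v ^ (Nat.card K - 1) * v := by
      rw [← pow_succ]; congr 1; omega
    have two : (2 : F) = 0 := CharTwo.two_eq_zero
    constructor
    · intro h
      have h3 : (a - x) ^ Nat.card K = v ^ (Nat.card K - 1) * (a - x) := by
        rw [e1]; linear_combination h - v ^ (Nat.card K - 1) * (a - x) * two
      obtain ⟨c, hc⟩ := aff_range (K := K) ((a - x) / v) (by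
        rw [div_pow, h3, e2]; field_simp)
      refine ⟨c, ?_⟩
      rw [Algebra.smul_def, hc]; field_simp; ring
    · rintro ⟨c, rfl⟩
      have hc : (algebraMap K F c) ^ Nat.card K = algebraMap K F c := by
        have := Fintype.ofFinite K
        rw [← map_pow, Nat.card_eq_fintype_card, FiniteField.pow_card]
      have : (x + c • v - x) ^ Nat.card K = c • (v ^ Nat.card K) := by
        rw [add_sub_cancel_left, Algebra.smul_def, mul_pow, hc, Algebra.smul_def]
      rw [e1, Algebra.smul_def, Algebra.smul_def, e2] at this
      rw [Algebra.smul_def]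
      linear_combination this + v ^ (Nat.card K - 1) * v * algebraMap K F c * two
  have hev := hA v hv x
  rw [← key, Set.ncard_coe_finset] at hev
  obtain ⟨m, hm⟩ := hev
  rw [hm, add_smul]; exact CharTwo.add_self_eq_zero _

open Polynomial in
lemma coeff_mul_expand {F : Type*} [Field F] (q : ℕ) (f g : F[X]) (hf : f.natDegree < q)
    (i l : ℕ) (hi : i < q) : (f * expand F q g).coeff (i + q * l) = f.coeff i * g.coeff l := by
  have hq : 0 < q := by omega
  rw [coeff_mul, Finset.sum_eq_single (i, q * l)]
  · rw [coeff_expand_mul' hq]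
  · rintro ⟨a, b⟩ hab hne
    rw [Finset.HasAntidiagonal.mem_antidiagonal] at hab
    dsimp only at hab ⊢
    by_cases ha : a < q
    · rw [coeff_expand hq]
      split_ifs with hd
      · exfalso
        obtain ⟨c, rfl⟩ := hd
        have h1 := congrArg (· % q) hab
        simp [Nat.mod_eq_of_lt ha, Nat.mod_eq_of_lt hi] at h1
        subst h1
        apply hne
        simp at hab
        simp [hab]
      · simp
    · rw [coeff_eq_zero_of_natDegree_lt (by omega), zero_mul]
  · intro h; simp at h

open Polynomial in
lemma coeff_lin_pow {F : Type*} [Field F] (a b : F) (k i : ℕ) (h : i ≤ k) :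
    ((C a + C b * X) ^ k).coeff i = a ^ (k - i) * b ^ i * k.choose i := by
  rw [add_comm, add_pow, finsetSum_coeff, Finset.sum_eq_single i]
  · have : (C b * X) ^ i * C a ^ (k - i) * ((k.choose i : ℕ) : F[X]) = C (b ^ i * a ^ (k - i) * (k.choose i : F)) * X ^ i := by
      simp only [C_mul, C_pow, mul_pow, map_natCast]; ring
    rw [this, coeff_C_mul, coeff_X_pow_self]; ring
  · intro j _ hj
    have : (C b * X) ^ j * C a ^ (k - j) * ((k.choose j : ℕ) : F[X]) = C (b ^ j * a ^ (k - j) * (k.choose j : F)) * X ^ j := by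
      simp only [C_mul, C_pow, mul_pow, map_natCast]; ring
    rw [this, coeff_C_mul, coeff_X_pow, if_neg hj.symm, mul_zero]
  · intro h'; simp at h'; omega

open Polynomial in
lemma aff_coeff {K F : Type*} [Field K] [Finite K] [Field F] [Finite F] [CharP F 2] [Algebra K F]
    (hF : Module.finrank K F = 3)
    (t : ℕ) (hq : Nat.card K = 2 ^ t) (A : Finset F)
    (hA : AffEven K (A : Set F)) (q : ℕ) (hqq : Nat.card K = q) (i a l b : ℕ)
    (h0 : i + a < q) (h1 : l + b < q) (c0 : Odd ((i + a).choose i)) (c1 : Odd ((l + b).choose l)) :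
    ∑ s ∈ A, s ^ (i + q * (a + l) + q ^ 2 * b) = 0 := by
  classical
  have := Fintype.ofFinite F
  have hq1 : 1 < q := hqq ▸ Finite.one_lt_card
  let P : F[X] := ∑ s ∈ A, (C (s ^ q) + C s * X) ^ (i + a) *
    expand F q ((C (s ^ q ^ 2) + C (s ^ q) * X) ^ (l + b))
  have hlin : ∀ (x y : F) (k : ℕ), ((C x + C y * X) ^ k).natDegree ≤ k := by
    intro x y k
    refine natDegree_pow_le.trans ?_
    have : (C x + C y * X).natDegree ≤ 1 := by compute_degree
    nlinarith
  have hdeg : P.natDegree ≤ q ^ 2 - 1 := by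
    apply natDegree_sum_le_of_forall_le
    intro s _
    refine natDegree_mul_le.trans ?_
    rw [natDegree_expand]
    have e0 := hlin (s ^ q) s (i + a)
    have e1 := hlin (s ^ q ^ 2) (s ^ q) (l + b)
    have e2 : q ^ 2 - 1 = (q - 1) + (q - 1) * q := by
      obtain ⟨r, rfl⟩ : ∃ r, q = r + 1 := ⟨q - 1, by omega⟩
      simp; ring_nf; omega
    rw [e2]
    apply Nat.add_le_add
    · omega
    · apply Nat.mul_le_mul_right; omega
  have hroot : ∀ v : F, v ≠ 0 → (P.comp (X ^ (q - 1))).eval v = 0 := by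
    intro v hv
    rw [eval_comp, eval_pow, eval_X, eval_finsetSum]
    rw [← aff_sum t hq A hA v hv (fun y => y ^ (i + a) * (y ^ q) ^ (l + b))]
    apply Finset.sum_congr rfl
    intro s _
    have hadd : ∀ x y : F, (x + y) ^ q = x ^ q + y ^ q := by
      intro x y; rw [← hqq, hq]; exact add_pow_char_pow ..
    simp only [eval_mul, eval_pow, eval_add, eval_C, eval_X, expand_eval, hqq, hadd, mul_pow]
    ring
  have hcardF : Fintype.card F = q ^ 3 := by
    have := Fintype.ofFinite K
    rw [Module.card_eq_pow_finrank (K := K), hF, ← Nat.card_eq_fintype_card, hqq]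
  have hcomp : P.comp (X ^ (q - 1)) = 0 := by
    apply eq_zero_of_natDegree_lt_card_of_eval_eq_zero' _ (Finset.univ.erase (0 : F))
    · intro v hv; exact hroot v (by simpa using hv)
    · rw [natDegree_comp, natDegree_X_pow, Finset.card_erase_of_mem (Finset.mem_univ _), Finset.card_univ, hcardF]
      refine lt_of_le_of_lt (Nat.mul_le_mul_right _ hdeg) ?_
      obtain ⟨r, rfl⟩ : ∃ r, q = r + 1 := ⟨q - 1, by omega⟩
      have e1 : (r + 1) ^ 2 - 1 = r * r + 2 * r := by rw [Nat.sub_eq_iff_eq_add (by nlinarith)]; ring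
      have e2 : (r + 1) ^ 3 - 1 = r ^ 3 + 3 * r ^ 2 + 3 * r := by
        rw [Nat.sub_eq_iff_eq_add (by linarith [pow_pos (show 0 < r + 1 by omega) 3])]; ring
      rw [e1, e2, Nat.add_sub_cancel]
      have : 0 < r := by omega
      nlinarith [pow_pos this 3, pow_pos this 2]
  have hP : P = 0 := by
    rw [comp_eq_zero_iff] at hcomp
    rcases hcomp with h | ⟨_, h⟩
    · exact h
    · have := congrArg natDegree h
      rw [natDegree_X_pow, natDegree_C] at this
      omega
  have hco := congrArg (fun p => coeff p (i + q * l)) hP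
  simp only [P, finsetSum_coeff, coeff_zero] at hco
  rw [← hco]
  apply Finset.sum_congr rfl
  intro s _
  rw [coeff_mul_expand q _ _ (lt_of_le_of_lt (hlin _ _ _) h0) i l (by omega),
    coeff_lin_pow _ _ _ _ (by omega), coeff_lin_pow _ _ _ _ (by omega)]
  have hodd : ∀ m : ℕ, Odd m → (m : F) = 1 := by
    rintro m ⟨k, rfl⟩
    have two : (2 : F) = 0 := CharTwo.two_eq_zero
    push_cast; rw [two]; ring
  rw [hodd _ c0, hodd _ c1, Nat.add_sub_cancel_left, Nat.add_sub_cancel_left]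
  simp only [← pow_mul, mul_one, ← pow_add]
  congr 1
  ring

lemma odd_choose_one (t i : ℕ) (hi : i < 2 ^ t) : Odd ((2 ^ t - 1).choose i) := by
  induction i with
  | zero => simp
  | succ i ih =>
    have h := ih (by omega)
    have e : (2 ^ t).choose (i + 1) = (2 ^ t - 1).choose i + (2 ^ t - 1).choose (i + 1) := by
      have : 2 ^ t = (2 ^ t - 1) + 1 := by omega
      conv_lhs => rw [this]
      rw [Nat.choose_succ_succ]
    have h2 : 2 ∣ (2 ^ t).choose (i + 1) := Nat.prime_two.dvd_choose_pow (by omega) (by omega)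
    rw [Nat.odd_iff] at h ⊢
    omega

lemma odd_choose_two (w l : ℕ) (hl : l < 2 ^ w) : Odd ((l + 2 ^ w).choose l) := by
  rw [Nat.add_choose_eq]
  rw [← Finset.sum_sdiff (s₁ := {(l, 0)}) (by simp), Finset.sum_singleton]
  rw [Nat.choose_self, Nat.choose_zero_right]
  apply Even.add_one
  apply Finset.even_sum
  rintro ⟨a, b⟩ hab
  simp only [Finset.mem_sdiff, Finset.HasAntidiagonal.mem_antidiagonal, Finset.mem_singleton, Prod.mk.injEq] at hab
  apply Even.mul_left
  rw [even_iff_two_dvd]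
  apply Nat.prime_two.dvd_choose_pow
  · rintro rfl; apply hab.2; simp at hab ⊢
  · dsimp only; omega

lemma aff_power {K F : Type*} [Field K] [Finite K] [Field F] [Finite F] [CharP F 2] [Algebra K F]
    (hF : Module.finrank K F = 3)
    (t : ℕ) (hq : Nat.card K = 2 ^ t) (A : Finset F)
    (hA : AffEven K (A : Set F)) (q : ℕ) (hqq : Nat.card K = q) (j : ℕ)
    (hj : j < q ^ 2 + 2 * q - 1) : ∑ s ∈ A, s ^ j = 0 := by
  have hq1 : 1 < q := hqq ▸ Finite.one_lt_card
  have key := aff_coeff hF t hq A hA q hqq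
  by_cases h1 : j < q ^ 2
  · have := key (j % q) 0 (j / q) 0 (by simpa using Nat.mod_lt _ (by omega))
      (by rw [add_zero, Nat.div_lt_iff_lt_mul (by omega)]; nlinarith) (by simp) (by simp)
    simpa [Nat.mod_add_div] using this
  obtain ⟨d, rfl⟩ : ∃ d, j = q ^ 2 + d := ⟨j - q ^ 2, by omega⟩
  by_cases h2 : d < q
  · have := key d 0 0 1 (by omega) (by omega) (by simp) (by simp)
    simpa [add_comm] using this
  obtain ⟨e, rfl⟩ : ∃ e, d = q + e := ⟨d - q, by omega⟩
  have he : e + 1 < q := by omega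
  obtain ⟨u, m, hm, hum⟩ := Nat.exists_eq_two_pow_mul_odd (n := e + 1) (by omega)
  obtain ⟨h, rfl⟩ := hm
  rcases Nat.eq_zero_or_pos u with rfl | hu
  · have := key e 1 0 1 (by omega) (by omega) (by
      rw [Nat.choose_symm_add, Nat.choose_one_right]; exact ⟨h, by omega⟩) (by simp)
    rw [← this]
    apply Finset.sum_congr rfl
    intro s _; congr 1; ring
  · have hut : u < t := by
      have : 2 ^ u < 2 ^ t := by rw [← hq, hqq]; nlinarith
      exact (Nat.pow_lt_pow_iff_right (by norm_num)).1 this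
    obtain ⟨w, rfl⟩ : ∃ w, t = u + w := ⟨t - u, by omega⟩
    have hqw : q = 2 ^ u * 2 ^ w := by rw [← hqq, hq, pow_add]
    have hh : 2 * h + 1 < 2 ^ w := by
      rw [hum, hqw] at he
      exact Nat.lt_of_mul_lt_mul_left he
    have hle : 2 ^ w * 2 ≤ q := by
      rw [hqw, mul_comm]
      apply Nat.mul_le_mul_right
      calc 2 = 2 ^ 1 := rfl
        _ ≤ 2 ^ u := Nat.pow_le_pow_right (by norm_num) hu
    have hwpos : 0 < 2 ^ w := by positivity
    have e1 : q - 2 ^ w + (2 ^ w - 1) = q - 1 := by omega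
    have := key (q - 2 ^ w) (2 ^ w - 1) (2 * h + 1) (2 ^ w) (by omega) (by omega)
      (by
        rw [e1, ← hqq, hq]
        apply odd_choose_one
        rw [← hq, hqq]; omega)
      (odd_choose_two _ _ hh)
    have hpow : (∑ s ∈ A, s ^ (q ^ 2 + (q + e))) ^ 2 ^ w = 0 := by
      rw [sum_pow_char_pow, ← this]
      apply Finset.sum_congr rfl
      intro s _
      rw [← pow_mul]
      congr 1
      have e3 : 2 ^ w - 1 + (2 * h + 1) = 2 ^ w + 2 * h := by omega
      rw [e3]
      have e4 : e * 2 ^ w + 2 ^ w = q * (2 * h + 1) := by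
        rw [← Nat.succ_mul, Nat.succ_eq_add_one, hum, hqw]; ring
      have e5 : q - 2 ^ w + 2 ^ w = q := by omega
      generalize q - 2 ^ w = z at *
      zify at *
      linear_combination e4 - e5
    exact pow_eq_zero_iff (by positivity) |>.1 hpow

open Polynomial in
lemma aff_bound {K F : Type*} [Field K] [Finite K] [Field F] [Finite F] [CharP F 2] [Algebra K F]
    (hF : Module.finrank K F = 3)
    (t : ℕ) (hq : Nat.card K = 2 ^ t) (A : Finset F)
    (hA : AffEven K (A : Set F)) (q : ℕ) (hqq : Nat.card K = q) (hne : A.Nonempty) :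
    q * (q + 2) ≤ A.card := by
  classical
  have hq1 : 1 < q := hqq ▸ Finite.one_lt_card
  by_contra hlt
  push Not at hlt
  obtain ⟨s0, hs0⟩ := hne
  let g : F[X] := ∏ s ∈ A.erase s0, (X - C s)
  have hg : g.natDegree < q ^ 2 + 2 * q - 1 := by
    rw [natDegree_prod_of_monic _ _ (fun s _ => monic_X_sub_C s)]
    simp only [natDegree_X_sub_C, Finset.sum_const, smul_eq_mul, mul_one]
    rw [Finset.card_erase_of_mem hs0]
    have : 0 < A.card := Finset.card_pos.2 ⟨_, hs0⟩
    have : q * (q + 2) = q ^ 2 + 2 * q := by ring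
    omega
  have h1 : ∑ s ∈ A, g.eval s = 0 := by
    simp only [eval_eq_sum_range]
    rw [Finset.sum_comm]
    apply Finset.sum_eq_zero
    intro j hj
    rw [Finset.mem_range] at hj
    rw [← Finset.mul_sum, aff_power hF t hq A hA q hqq j (by omega), mul_zero]
  rw [Finset.sum_eq_single s0] at h1
  · rw [eval_prod, Finset.prod_eq_zero_iff] at h1
    obtain ⟨s, hs, h⟩ := h1
    simp [sub_eq_zero] at h
    simp [h] at hs
  · intro s hs hne
    rw [eval_prod]
    apply Finset.prod_eq_zero (i := s)
    · simp [hs, hne]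
    · simp
  · exact fun h => absurd hs0 h

section geometry
set_option linter.unusedSectionVars false
variable {K : Type*} [Field K] [Finite K] {n : ℕ}


lemma pg_finite : Finite (PGPoint K n) := by unfold PGPoint; infer_instance

/-- the point spanned by a nonzero vector -/
def mkPt (v : Fin (n + 1) → K) (hv : v ≠ 0) : PGPoint K n :=
  ⟨span K {v}, finrank_span_singleton hv⟩

lemma exists_rep (P : PGPoint K n) : ∃ p : Fin (n + 1) → K, p ≠ 0 ∧ P.1 = span K {p} := by
  obtain ⟨v, hv, h⟩ := finrank_eq_one_iff'.1 P.2
  refine ⟨v.1, by simpa using hv, le_antisymm ?_ ?_⟩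
  · intro x hx
    obtain ⟨c, hc⟩ := h ⟨x, hx⟩
    rw [mem_span_singleton]
    exact ⟨c, congrArg Subtype.val hc⟩
  · rw [span_singleton_le_iff_mem]; exact v.2

lemma mem_pts (P : PGPoint K n) (W : Submodule K (Fin (n + 1) → K)) : P ∈ pts W ↔ P.1 ≤ W := Iff.rfl

lemma mkPt_mem (v : Fin (n + 1) → K) (hv : v ≠ 0) (W : Submodule K (Fin (n + 1) → K)) :
    mkPt v hv ∈ pts W ↔ v ∈ W := span_singleton_le_iff_mem v W

lemma card_diff_sub (U X : Submodule K (Fin (n + 1) → K)) (h : U ≤ X) :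
    {w | w ∈ X ∧ w ∉ U}.ncard = Nat.card K ^ Module.finrank K X - Nat.card K ^ Module.finrank K U := by
  have e : {w | w ∈ X ∧ w ∉ U} = (X : Set (Fin (n + 1) → K)) \ U := by ext; simp
  rw [e, Set.ncard_sdiff (by exact_mod_cast h) (Set.toFinite _), ← Nat.card_coe_set_eq, ← Nat.card_coe_set_eq]
  have h1 := Module.natCard_eq_pow_finrank (K := K) (V := X)
  have h2 := Module.natCard_eq_pow_finrank (K := K) (V := U)
  rw [← h1, ← h2]; rfl

open Classical in
lemma key_count [Fintype (Fin (n + 1) → K)] (S : Set (PGPoint K n)) (U W : Submodule K (Fin (n + 1) → K)) (hUW : U ≤ W) :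
    ∑ w ∈ Finset.univ.filter (fun w => w ∈ W ∧ w ∉ U), ((S ∩ pts (U ⊔ span K {w})) \ pts U).ncard
      = ((S ∩ pts W) \ pts U).ncard *
        (Nat.card K ^ (Module.finrank K U + 1) - Nat.card K ^ Module.finrank K U) := by
  have := pg_finite (K := K) (n := n)
  obtain ⟨T, hT⟩ : ∃ T : Finset (PGPoint K n), (T : Set (PGPoint K n)) = (S ∩ pts W) \ pts U :=
    ⟨(Set.toFinite _).toFinset, Set.Finite.coe_toFinset _⟩
  have hT' : ∀ P, P ∈ T ↔ (P ∈ S ∧ P.1 ≤ W) ∧ ¬ P.1 ≤ U := by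
    intro P
    rw [← Finset.mem_coe, hT]; rfl
  have h := Finset.sum_card_bipartiteAbove_eq_sum_card_bipartiteBelow
    (fun (w : Fin (n + 1) → K) (P : PGPoint K n) => P.1 ≤ U ⊔ span K {w})
    (s := Finset.univ.filter (fun w => w ∈ W ∧ w ∉ U)) (t := T)
  have e1 : ∀ w ∈ Finset.univ.filter (fun w => w ∈ W ∧ w ∉ U),
      ((S ∩ pts (U ⊔ span K {w})) \ pts U).ncard = (Finset.bipartiteAbove
        (fun (w : Fin (n + 1) → K) (P : PGPoint K n) => P.1 ≤ U ⊔ span K {w})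
        T w).card := by
    intro w hw
    simp only [Finset.mem_filter, Finset.mem_univ, true_and] at hw
    rw [← Set.ncard_coe_finset]
    congr 1
    ext P
    simp only [Finset.bipartiteAbove, Set.mem_sdiff, Set.mem_inter_iff, Set.mem_ofPred_eq,
      Finset.coe_filter, hT', mem_pts]
    have : P.1 ≤ U ⊔ span K {w} → P.1 ≤ W := fun h => h.trans (sup_le hUW (by
      rw [span_singleton_le_iff_mem]; exact hw.1))
    exact ⟨fun ⟨⟨a, b⟩, c⟩ => ⟨⟨⟨a, this b⟩, c⟩, b⟩, fun ⟨⟨⟨a, _⟩, c⟩, b⟩ => ⟨⟨a, b⟩, c⟩⟩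
  have e2 : ∀ P ∈ T, (Finset.bipartiteBelow
      (fun (w : Fin (n + 1) → K) (P : PGPoint K n) => P.1 ≤ U ⊔ span K {w})
      (Finset.univ.filter (fun w => w ∈ W ∧ w ∉ U)) P).card =
      Nat.card K ^ (Module.finrank K U + 1) - Nat.card K ^ Module.finrank K U := by
    intro P hP
    obtain ⟨⟨_, hPW⟩, hPU⟩ := (hT' P).1 hP
    obtain ⟨p, hp, hPp⟩ := exists_rep P
    rw [hPp, span_singleton_le_iff_mem] at hPW hPU
    rw [← finrank_sup_span_singleton hPU, ← card_diff_sub U _ le_sup_left, ← Set.ncard_coe_finset]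
    congr 1
    have exch : ∀ a b : Fin (n + 1) → K, a ∉ U → a ∈ U ⊔ span K {b} → b ∈ U ⊔ span K {a} := by
      intro a b ha hab
      obtain ⟨y, hy, z, hz, rfl⟩ := mem_sup.1 hab
      obtain ⟨c, rfl⟩ := mem_span_singleton.1 hz
      have hc : c ≠ 0 := by
        rintro rfl
        apply ha; simpa using hy
      have : b = - (c⁻¹ • y) + c⁻¹ • (y + c • b) := by
        rw [smul_add, smul_smul, inv_mul_cancel₀ hc, one_smul]; abel
      exact mem_sup.2 ⟨-(c⁻¹ • y), U.neg_mem (U.smul_mem _ hy), c⁻¹ • (y + c • b),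
        mem_span_singleton.2 ⟨_, rfl⟩, this.symm⟩
    ext w
    simp only [Finset.bipartiteBelow, Finset.coe_filter, Finset.mem_filter, Finset.mem_univ, true_and,
      Set.mem_ofPred_eq, hPp, span_singleton_le_iff_mem]
    constructor
    · rintro ⟨⟨h1, h2⟩, h3⟩
      exact ⟨exch _ _ hPU h3, h2⟩
    · rintro ⟨h1, h2⟩
      refine ⟨⟨?_, h2⟩, exch _ _ h2 h1⟩
      have : U ⊔ span K {p} ≤ W := sup_le hUW (by rw [span_singleton_le_iff_mem]; exact hPW)
      exact this h1
  rw [Finset.sum_congr rfl e1, h, Finset.sum_congr rfl e2, Finset.sum_const, smul_eq_mul,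
    ← hT, Set.ncard_coe_finset]

lemma count_le (S : Set (PGPoint K n)) (U W : Submodule K (Fin (n + 1) → K)) (hUW : U ≤ W) (c : ℕ)
    (hc : ∀ w ∈ W, w ∉ U → c ≤ ((S ∩ pts (U ⊔ span K {w})) \ pts U).ncard) :
    c * (Nat.card K ^ Module.finrank K W - Nat.card K ^ Module.finrank K U) ≤
     ((S ∩ pts W) \ pts U).ncard *
        (Nat.card K ^ (Module.finrank K U + 1) - Nat.card K ^ Module.finrank K U) := by
  classical
  have := Fintype.ofFinite (Fin (n + 1) → K)
  rw [← key_count S U W hUW, ← card_diff_sub U W hUW]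
  have : {w | w ∈ W ∧ w ∉ U}.ncard = (Finset.univ.filter (fun w => w ∈ W ∧ w ∉ U)).card := by
    rw [← Set.ncard_coe_finset]; congr 1; ext; simp
  rw [this, mul_comm, ← smul_eq_mul]
  apply Finset.card_nsmul_le_sum
  intro w hw
  simp only [Finset.mem_filter, Finset.mem_univ, true_and] at hw
  exact hc w hw.1 hw.2

lemma count_eq (S : Set (PGPoint K n)) (U W : Submodule K (Fin (n + 1) → K)) (hUW : U ≤ W) (c : ℕ)
    (hc : ∀ w ∈ W, w ∉ U → c ≤ ((S ∩ pts (U ⊔ span K {w})) \ pts U).ncard)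
    (heq : c * (Nat.card K ^ Module.finrank K W - Nat.card K ^ Module.finrank K U) =
     ((S ∩ pts W) \ pts U).ncard *
        (Nat.card K ^ (Module.finrank K U + 1) - Nat.card K ^ Module.finrank K U)) :
    ∀ w ∈ W, w ∉ U → c = ((S ∩ pts (U ⊔ span K {w})) \ pts U).ncard := by
  classical
  have := Fintype.ofFinite (Fin (n + 1) → K)
  rw [← key_count S U W hUW, ← card_diff_sub U W hUW] at heq
  have : {w | w ∈ W ∧ w ∉ U}.ncard = (Finset.univ.filter (fun w => w ∈ W ∧ w ∉ U)).card := by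
    rw [← Set.ncard_coe_finset]; congr 1; ext; simp
  rw [this, mul_comm, ← smul_eq_mul, ← Finset.sum_const] at heq
  rw [Finset.sum_eq_sum_iff_of_le] at heq
  · intro w h1 h2
    exact heq w (by simp [h1, h2])
  · intro w hw
    simp only [Finset.mem_filter, Finset.mem_univ, true_and] at hw
    exact hc w hw.1 hw.2

lemma pts_mono {U X : Submodule K (Fin (n + 1) → K)} (h : U ≤ X) : pts U ⊆ pts (n := n) X :=
  fun _ hP => le_trans hP h

lemma diff_add (S : Set (PGPoint K n)) (U X : Submodule K (Fin (n + 1) → K)) (h : U ≤ X) :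
    ((S ∩ pts X) \ pts U).ncard + (S ∩ pts U).ncard = (S ∩ pts X).ncard := by
  have := pg_finite (K := K) (n := n)
  rw [← Set.ncard_sdiff_add_ncard_of_subset (s := S ∩ pts U) (t := S ∩ pts X)
    (Set.inter_subset_inter_right _ (pts_mono h)) (Set.toFinite _)]
  congr 2
  ext P; simp only [Set.mem_sdiff, Set.mem_inter_iff]; tauto

lemma pts_point (P : PGPoint K n) : pts P.1 = {P} := by
  ext Q
  simp only [pts, Set.mem_ofPred_eq, Set.mem_singleton_iff]
  constructor
  · intro h
    apply Subtype.ext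
    exact eq_of_le_of_finrank_eq h (by rw [P.2, Q.2])
  · rintro rfl; exact le_rfl

lemma pts_bot : pts (⊥ : Submodule K (Fin (n + 1) → K)) = ∅ := by
  ext Q
  simp only [pts, Set.mem_ofPred_eq, Set.mem_empty_iff_false, iff_false]
  intro h
  have := Q.2
  rw [le_bot_iff.1 h] at this
  simp at this

lemma even_line (S : Set (PGPoint K n)) (hS : IsEvenType S) (X : Submodule K (Fin (n + 1) → K))
    (hX : Module.finrank K X = 2) : Even (S ∩ pts X).ncard := hS _ ⟨X, hX, rfl⟩

lemma plane_bound (S : Set (PGPoint K n)) (hS : IsEvenType S) (W : Submodule K (Fin (n + 1) → K))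
    (hW : Module.finrank K W = 3) (hne : (S ∩ pts W).ncard ≠ 0) :
    Nat.card K + 2 ≤ (S ∩ pts W).ncard := by
  have := pg_finite (K := K) (n := n)
  have hq1 : 1 < Nat.card K := Finite.one_lt_card
  obtain ⟨P, hPS, hPW⟩ := Set.nonempty_of_ncard_ne_zero hne
  have hPS1 : (S ∩ pts P.1).ncard = 1 := by
    rw [pts_point, Set.inter_eq_right.2 (by simpa using hPS), Set.ncard_singleton]
  have h := count_le S P.1 W hPW 1 (by
    intro w hw hwP
    have h1 := diff_add S P.1 (P.1 ⊔ span K {w}) le_sup_left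
    obtain ⟨k, hk⟩ := even_line S hS (P.1 ⊔ span K {w}) (by rw [finrank_sup_span_singleton hwP, P.2])
    omega)
  have h2 := diff_add S P.1 W hPW
  rw [hPS1] at h2
  rw [hW, P.2] at h
  generalize ((S ∩ pts W) \ pts P.1).ncard = d at *
  generalize Nat.card K = q at *
  obtain ⟨r, rfl⟩ : ∃ r, q = r + 1 := ⟨q - 1, by omega⟩
  have e1 : (r + 1) ^ 3 - (r + 1) ^ 1 = (r + 2) * (r * (r + 1)) := by
    rw [Nat.sub_eq_iff_eq_add (Nat.pow_le_pow_right (by omega) (by omega))]; ring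
  have e2 : (r + 1) ^ (1 + 1) - (r + 1) ^ 1 = r * (r + 1) := by
    rw [Nat.sub_eq_iff_eq_add (Nat.pow_le_pow_right (by omega) (by omega))]; ring
  rw [e1, e2, one_mul] at h
  have := Nat.le_of_mul_le_mul_right h (by have : 0 < r := by omega
                                           positivity)
  omega

lemma exists_ext_line (S : Set (PGPoint K n)) (hS : IsEvenType S) (W : Submodule K (Fin (n + 1) → K))
    (hW : Module.finrank K W = 3) (hc : (S ∩ pts W).ncard = Nat.card K + 2) :
    ∃ X ≤ W, Module.finrank K X = 2 ∧ (S ∩ pts X).ncard = 0 := by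
  have := pg_finite (K := K) (n := n)
  have hq1 : 1 < Nat.card K := Finite.one_lt_card
  obtain ⟨Q, hQW, hQS⟩ : ∃ Q : PGPoint K n, Q.1 ≤ W ∧ Q ∉ S := by
    by_contra hcon
    push Not at hcon
    have h := count_le S ⊥ W bot_le 1 (by
      intro w hw hw0
      rw [Nat.one_le_iff_ne_zero, ← Nat.pos_iff_ne_zero, Set.ncard_pos (Set.toFinite _)]
      have hw0' : w ≠ 0 := by simpa using hw0
      have hle : (mkPt w hw0').1 ≤ W := by
        simp only [mkPt, span_singleton_le_iff_mem]; exact hw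
      refine ⟨mkPt w hw0', ⟨hcon _ hle, ?_⟩, by simp [pts_bot]⟩
      exact (mkPt_mem _ _ _).2 (mem_sup_right (mem_span_singleton_self w)))
    rw [pts_bot, Set.sdiff_empty, hc, hW, finrank_bot] at h
    generalize Nat.card K = q at *
    obtain ⟨r, rfl⟩ : ∃ r, q = r + 1 := ⟨q - 1, by omega⟩
    have e1 : (r + 1) ^ 3 - (r + 1) ^ 0 = r ^ 3 + 3 * r ^ 2 + 3 * r := by
      rw [Nat.sub_eq_iff_eq_add (Nat.pow_le_pow_right (by omega) (by omega))]; ring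
    have e2 : (r + 1) ^ (0 + 1) - (r + 1) ^ 0 = r := by simp
    rw [e1, e2] at h
    have : 0 < r := by omega
    nlinarith [pow_pos this 3, pow_pos this 2]
  by_contra hcon
  push Not at hcon
  have hQS0 : (S ∩ pts Q.1).ncard = 0 := by
    rw [pts_point, Set.inter_singleton_eq_empty.2 hQS, Set.ncard_empty]
  have h := count_le S Q.1 W hQW 2 (by
    intro w hw hwP
    have h1 := diff_add S Q.1 (Q.1 ⊔ span K {w}) le_sup_left
    have hfr : Module.finrank K (Q.1 ⊔ span K {w} : Submodule K (Fin (n + 1) → K)) = 2 := by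
      rw [finrank_sup_span_singleton hwP, Q.2]
    obtain ⟨k, hk⟩ := even_line S hS (Q.1 ⊔ span K {w}) hfr
    have := hcon (Q.1 ⊔ span K {w}) (sup_le hQW (by rw [span_singleton_le_iff_mem]; exact hw)) hfr
    omega)
  have h2 := diff_add S Q.1 W hQW
  rw [hQS0, hc] at h2
  rw [hW, Q.2] at h
  generalize ((S ∩ pts W) \ pts Q.1).ncard = d at *
  generalize Nat.card K = q at *
  obtain ⟨r, rfl⟩ : ∃ r, q = r + 1 := ⟨q - 1, by omega⟩
  have e1 : (r + 1) ^ 3 - (r + 1) ^ 1 = (r + 2) * (r * (r + 1)) := by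
    rw [Nat.sub_eq_iff_eq_add (Nat.pow_le_pow_right (by omega) (by omega))]; ring
  have e2 : (r + 1) ^ (1 + 1) - (r + 1) ^ 1 = r * (r + 1) := by
    rw [Nat.sub_eq_iff_eq_add (Nat.pow_le_pow_right (by omega) (by omega))]; ring
  rw [e1, e2, ← mul_assoc] at h
  have := Nat.le_of_mul_le_mul_right h (by have : 0 < r := by omega
                                           positivity)
  omega

lemma affine_solid (hq : Even (Nat.card K)) (S : Set (PGPoint K n)) (hS : IsEvenType S)
    (X W : Submodule K (Fin (n + 1) → K)) (hXW : X ≤ W)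
    (hX : Module.finrank K X = 3) (hW : Module.finrank K W = 4) (hX0 : (S ∩ pts X).ncard = 0)
    (hne : (S ∩ pts W).ncard ≠ 0) :
    Nat.card K * (Nat.card K + 2) ≤ (S ∩ pts W).ncard := by
  classical
  have := pg_finite (K := K) (n := n)
  obtain ⟨t, hchar, ht⟩ : ∃ t : ℕ, CharP K 2 ∧ Nat.card K = 2 ^ t := by
    have := Fintype.ofFinite K
    obtain ⟨p, hp, m, hpr, hc⟩ := FiniteField.card' K
    rw [← Nat.card_eq_fintype_card] at hc
    have h2 : p = 2 := by
      rw [hc, even_iff_two_dvd] at hq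
      exact ((Nat.prime_dvd_prime_iff_eq Nat.prime_two hpr).1 (Nat.prime_two.dvd_of_dvd_pow hq)).symm
    subst h2
    exact ⟨m, hp, hc⟩
  have : Fact (Nat.Prime 2) := ⟨Nat.prime_two⟩
  let F := FiniteField.Extension K 2 3
  have hF : Module.finrank K F = 3 := FiniteField.finrank_extension K 2 3
  have : CharP F 2 := charP_of_injective_algebraMap (algebraMap K F).injective 2
  let φ : F ≃ₗ[K] X := LinearEquiv.ofFinrankEq F X (by rw [hF, hX])
  have hSX : ∀ P ∈ S, ¬ P.1 ≤ X := by
    intro P hP hPX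
    rw [Set.ncard_eq_zero (Set.toFinite _)] at hX0
    exact Set.notMem_empty P (hX0 ▸ ⟨hP, hPX⟩)
  obtain ⟨e, heW, heX⟩ : ∃ e ∈ W, e ∉ X := by
    by_contra hcon
    push Not at hcon
    have := finrank_mono (R := K) (show W ≤ X from hcon)
    omega
  have hWe : X ⊔ span K {e} = W := by
    apply eq_of_le_of_finrank_eq (sup_le hXW (by rw [span_singleton_le_iff_mem]; exact heW))
    rw [finrank_sup_span_singleton heX, hX, hW]
  have hnX : ∀ f : F, e + (φ f : Fin (n + 1) → K) ∉ X := by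
    intro f hf
    exact heX ((X.add_mem_iff_left (φ f).2).1 hf)
  have hn0 : ∀ f : F, e + (φ f : Fin (n + 1) → K) ≠ 0 := by
    intro f h0
    exact hnX f (h0 ▸ X.zero_mem)
  let G : F → PGPoint K n := fun f => mkPt _ (hn0 f)
  have hGinj : Function.Injective G := by
    intro f g hfg
    have h1 : span K {e + (φ f : Fin (n + 1) → K)} = span K {e + (φ g : Fin (n + 1) → K)} :=
      congrArg Subtype.val hfg
    have h2 : e + (φ f : Fin (n + 1) → K) ∈ span K {e + (φ g : Fin (n + 1) → K)} := by
      rw [← h1]; exact mem_span_singleton_self _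
    obtain ⟨c, hc⟩ := mem_span_singleton.1 h2
    have h3 : (1 - c) • e ∈ X := by
      have : (1 - c) • e = c • (φ g : Fin (n + 1) → K) - (φ f : Fin (n + 1) → K) := by
        rw [smul_add] at hc
        rw [sub_smul, one_smul, sub_eq_sub_iff_add_eq_add, ← hc]; abel
      rw [this]
      exact X.sub_mem (X.smul_mem _ (φ g).2) (φ f).2
    have hc1 : 1 - c = 0 := by
      by_contra hcne
      exact heX ((X.smul_mem_iff hcne).1 h3)
    have hc1' : c = 1 := (sub_eq_zero.1 hc1).symm
    rw [hc1', one_smul] at hc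
    exact (φ.injective (Subtype.ext (add_left_cancel hc))).symm
  have hGsurj : ∀ P ∈ S, P.1 ≤ W → ∃ f, G f = P := by
    intro P hPS hPW
    obtain ⟨p, hp, hPp⟩ := exists_rep P
    have hpX : p ∉ X := by
      intro h; exact hSX P hPS (by rw [hPp, span_singleton_le_iff_mem]; exact h)
    have hpW : p ∈ W := by rw [← span_singleton_le_iff_mem, ← hPp]; exact hPW
    rw [← hWe] at hpW
    obtain ⟨y, hy, z, hz, rfl⟩ := mem_sup.1 hpW
    obtain ⟨c, rfl⟩ := mem_span_singleton.1 hz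
    have hc : c ≠ 0 := by
      rintro rfl
      apply hpX; simpa using hy
    refine ⟨φ.symm ⟨c⁻¹ • y, X.smul_mem _ hy⟩, Subtype.ext ?_⟩
    simp only [G, mkPt, LinearEquiv.apply_symm_apply]
    rw [hPp, ← span_singleton_smul_eq (IsUnit.mk0 _ (inv_ne_zero hc)) (y + c • e), smul_add, smul_smul,
      inv_mul_cancel₀ hc, one_smul, add_comm e]
  have hGW : ∀ f, (G f).1 ≤ W := by
    intro f
    simp only [G, mkPt, span_singleton_le_iff_mem]
    exact W.add_mem heW (hXW (φ f).2)
  have hfin : (G ⁻¹' S).Finite := Set.toFinite _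
  have hcardA : hfin.toFinset.card = (S ∩ pts W).ncard := by
    rw [← Set.ncard_eq_toFinset_card, ← Set.ncard_image_of_injective _ hGinj]
    congr 1
    ext P
    constructor
    · rintro ⟨f, hf, rfl⟩; exact ⟨hf, hGW f⟩
    · rintro ⟨hP, hPW⟩
      obtain ⟨f, rfl⟩ := hGsurj P hP hPW
      exact ⟨f, hP, rfl⟩
  rw [← hcardA]
  refine aff_bound hF t ht hfin.toFinset ?_ _ rfl ?_
  · rw [Set.Finite.coe_toFinset]
    intro v hv x
    have hv0 : (φ v : Fin (n + 1) → K) ≠ 0 := by simpa using hv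
    have hnot : e + (φ x : Fin (n + 1) → K) ∉ span K {(φ v : Fin (n + 1) → K)} := by
      intro h
      have : span K {(φ v : Fin (n + 1) → K)} ≤ X := by
        rw [span_singleton_le_iff_mem]; exact (φ v).2
      exact hnX x (this h)
    have hev := even_line S hS (span K {(φ v : Fin (n + 1) → K)} ⊔ span K {e + (φ x : Fin (n + 1) → K)})
      (by rw [finrank_sup_span_singleton hnot, finrank_span_singleton hv0])
    rw [← Set.ncard_image_of_injective _ hGinj]
    convert hev using 2
    ext P
    constructor
    · rintro ⟨f, ⟨hf, c, rfl⟩, rfl⟩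
      refine ⟨hf, ?_⟩
      refine (mkPt_mem _ _ _).2 ?_
      refine mem_sup.2 ⟨c • (φ v : Fin (n + 1) → K), mem_span_singleton.2 ⟨c, rfl⟩, _, mem_span_singleton_self _, ?_⟩
      simp; abel
    · rintro ⟨hPS, hPL⟩
      have hPW : P.1 ≤ W := by
        refine le_trans hPL (sup_le ?_ ?_)
        · rw [span_singleton_le_iff_mem]; exact hXW (φ v).2
        · exact hGW x
      obtain ⟨f, rfl⟩ := hGsurj P hPS hPW
      refine ⟨f, ⟨hPS, ?_⟩, rfl⟩
      replace hPL := (mkPt_mem _ _ _).1 hPL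
      obtain ⟨y, hy, z, hz, hyz⟩ := mem_sup.1 hPL
      obtain ⟨c, rfl⟩ := mem_span_singleton.1 hy
      obtain ⟨d, rfl⟩ := mem_span_singleton.1 hz
      have h3 : (1 - d) • e ∈ X := by
        have : (1 - d) • e = c • (φ v : Fin (n + 1) → K) + d • (φ x : Fin (n + 1) → K) - (φ f : Fin (n + 1) → K) := by
          rw [smul_add] at hyz
          rw [sub_smul, one_smul, sub_eq_sub_iff_add_eq_add, ← hyz]; abel
        rw [this]
        exact X.sub_mem (X.add_mem (X.smul_mem _ (φ v).2) (X.smul_mem _ (φ x).2)) (φ f).2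
      have hc1 : 1 - d = 0 := by
        by_contra hcne
        exact heX ((X.smul_mem_iff hcne).1 h3)
      have hc1' : d = 1 := (sub_eq_zero.1 hc1).symm
      rw [hc1', one_smul] at hyz
      refine ⟨c, φ.injective (Subtype.ext ?_)⟩
      have : e + (φ f : Fin (n + 1) → K) = e + ((φ x : Fin (n + 1) → K) + c • (φ v : Fin (n + 1) → K)) := by
        rw [← hyz]; abel
      simpa using add_left_cancel this
  · rw [← Finset.card_pos, hcardA]; omega

lemma solid_bound (hq : Even (Nat.card K)) (S : Set (PGPoint K n)) (hS : IsEvenType S)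
    (U W : Submodule K (Fin (n + 1) → K)) (hUW : U ≤ W)
    (hU : Module.finrank K U = 3) (hW : Module.finrank K W = 4)
    (hc : (S ∩ pts U).ncard = Nat.card K + 2) :
    Nat.card K * (Nat.card K + 2) ≤ (S ∩ pts W).ncard := by
  have hq1 : 1 < Nat.card K := Finite.one_lt_card
  obtain ⟨Y, hYU, hY, hY0⟩ := exists_ext_line S hS U hU hc
  have hYW := hYU.trans hUW
  by_cases hex : ∃ X ≤ W, Module.finrank K X = 3 ∧ (S ∩ pts X).ncard = 0
  · obtain ⟨X, hXW, hX, hX0⟩ := hex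
    apply affine_solid hq S hS X W hXW hX hW hX0
    have := diff_add S U W hUW
    omega
  push Not at hex
  have h := count_le S Y W hYW (Nat.card K + 2) (by
    intro w hw hwY
    have h1 := diff_add S Y (Y ⊔ span K {w}) le_sup_left
    have hfr : Module.finrank K (Y ⊔ span K {w} : Submodule K (Fin (n + 1) → K)) = 3 := by
      rw [finrank_sup_span_singleton hwY, hY]
    have h2 := plane_bound S hS _ hfr
      (hex _ (sup_le hYW (by rw [span_singleton_le_iff_mem]; exact hw)) hfr)
    omega)
  have h2 := diff_add S Y W hYW
  rw [hY0] at h2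
  rw [hW, hY] at h
  generalize ((S ∩ pts W) \ pts Y).ncard = d at *
  generalize Nat.card K = q at *
  obtain ⟨r, rfl⟩ : ∃ r, q = r + 1 := ⟨q - 1, by omega⟩
  have e1 : (r + 1) ^ 4 - (r + 1) ^ 2 = (r + 2) * (r * (r + 1) ^ 2) := by
    rw [Nat.sub_eq_iff_eq_add (Nat.pow_le_pow_right (by omega) (by omega))]; ring
  have e2 : (r + 1) ^ (2 + 1) - (r + 1) ^ 2 = r * (r + 1) ^ 2 := by
    rw [Nat.sub_eq_iff_eq_add (Nat.pow_le_pow_right (by omega) (by omega))]; ring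
  rw [e1, e2, ← mul_assoc] at h
  have := Nat.le_of_mul_le_mul_right h (by have : 0 < r := by omega
                                           positivity)
  nlinarith

end geometry

/-- Let `q` be an even prime power, `n ≥ 4`, `S` a set of
even type of size `(q+2)q^{n-2}` in `PG(n,q)`, and `π` a plane with
`|S ∩ π| = q + 2`.  Then every `3`-space (solid) of `PG(n,q)` containing `π`
meets `S` in exactly `q(q+2)` points. -/
theorem stmt18 {K : Type*} [Field K] [Finite K] (hq : Even (Nat.card K))
    (n : ℕ) (hn : 4 ≤ n) (S : Set (PGPoint K n)) (hS : IsEvenType S)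
    (hcard : S.ncard = (Nat.card K + 2) * Nat.card K ^ (n - 2))
    (π : Set (PGPoint K n)) (hπ : IsKSpace 2 π)
    (hSπ : (S ∩ π).ncard = Nat.card K + 2) :
    ∀ σ : Set (PGPoint K n), IsKSpace 3 σ → π ⊆ σ →
      (S ∩ σ).ncard = Nat.card K * (Nat.card K + 2) := by
  intro σ hσ hπσ
  obtain ⟨U, hU, rfl⟩ := hπ
  obtain ⟨W, hW, rfl⟩ := hσ
  have hq1 : 1 < Nat.card K := Finite.one_lt_card
  have hUW : U ≤ W := by
    intro p hp
    by_cases hp0 : p = 0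
    · rw [hp0]; exact W.zero_mem
    · have h1 : mkPt p hp0 ∈ pts U := by
        change span K {p} ≤ U
        rw [span_singleton_le_iff_mem]; exact hp
      have h2 : span K {p} ≤ W := hπσ h1
      rwa [span_singleton_le_iff_mem] at h2
  have hbd : ∀ w ∈ (⊤ : Submodule K (Fin (n + 1) → K)), w ∉ U →
      (Nat.card K - 1) * (Nat.card K + 2) ≤ ((S ∩ pts (U ⊔ span K {w})) \ pts U).ncard := by
    intro w _ hwU
    have h1 := diff_add S U (U ⊔ span K {w}) le_sup_left
    have h2 := solid_bound hq S hS U (U ⊔ span K {w}) le_sup_left hU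
      (by rw [finrank_sup_span_singleton hwU, hU]) hSπ
    rw [hSπ] at h1
    rw [Nat.sub_mul, one_mul]
    omega
  have htop : S ∩ pts (⊤ : Submodule K (Fin (n + 1) → K)) = S := by
    rw [Set.inter_eq_left]; intro P _; exact le_top (a := P.1)
  have hall := count_eq S U ⊤ le_top _ hbd (by
    have h1 := diff_add S U ⊤ le_top
    rw [htop, hSπ, hcard] at h1
    rw [htop, hU, finrank_top, Module.finrank_fin_fun]
    obtain ⟨m, rfl⟩ : ∃ m, n = m + 2 := ⟨n - 2, by omega⟩
    rw [Nat.add_sub_cancel] at h1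
    generalize (S \ pts U).ncard = d at *
    generalize Nat.card K = q at *
    have e1 : q ^ 3 ≤ q ^ (m + 2 + 1) := Nat.pow_le_pow_right (by omega) (by omega)
    have e2 : q ^ 3 ≤ q ^ 4 := Nat.pow_le_pow_right (by omega) (by omega)
    have e3 : 1 ≤ q := by omega
    zify [e1, e2, e3] at h1 ⊢
    have : (d : ℤ) = (q + 2) * q ^ m - (q + 2) := by linarith
    rw [this]
    ring)
  obtain ⟨w, hwW, hwU⟩ : ∃ w ∈ W, w ∉ U := by
    by_contra hcon
    push Not at hcon
    have := finrank_mono (R := K) (show W ≤ U from hcon)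
    omega
  have hWe : U ⊔ span K {w} = W := by
    apply eq_of_le_of_finrank_eq (sup_le hUW (by rw [span_singleton_le_iff_mem]; exact hwW))
    rw [finrank_sup_span_singleton hwU, hU, hW]
  have h1 := hall w mem_top hwU
  have h2 := diff_add S U W hUW
  rw [hWe] at h1
  rw [← h2, ← h1, hSπ]
  obtain ⟨r, hr⟩ : ∃ r, Nat.card K = r + 1 := ⟨Nat.card K - 1, by omega⟩
  rw [hr, Nat.add_sub_cancel]; ring
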